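/- arXiv:1504.00994 — 2 statements merged into one kernel-verified Lean document; each statement's English description precedes it below -/
import Mathlib

section
/- Let W be a finitely generated A-module and let σ : G → Aut_A(W) be a representation such that for every g ∈ G the relation σ(g)² − (tr g)·σ(g) + (det g)·id_W = 0 holds in End_A(W) (i.e. σ(g) satisfies the characteristic polynomial of ρ(g)). Then there exists an A-module U₀ and an isomorphism of A[G]-modules σ ≅ ρ ⊗_A U₀, i.e. W with its G-action is isomorphic to V ⊗_A U₀ with G acting through ρ on the first factor and trivially on the second. -/
open TensorProduct

theorem core_ker {A R S : Type*} [CommRing A] [Ring R] [Ring S] [Algebra A R] [Algebra A S]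
    (φ : R →ₐ[A] Matrix (Fin 2) (Fin 2) A) (ψ : R →ₐ[A] S)
    (ha : ∀ x y, ψ (x * y) + ψ (y * x) = (φ y).trace • ψ x + (φ x).trace • ψ y
      + ((φ (x * y)).trace - (φ x).trace * (φ y).trace) • (1 : S))
    (hq : ∀ x, ψ x * ψ x - (φ x).trace • ψ x + (φ x).det • (1 : S) = 0)
    (hs : Function.Surjective φ) (x : R) (hx : φ x = 0) : ψ x = 0 := by
  have h1 : ∀ y, ψ x * ψ y = ((φ y).trace • 1 - ψ y) * ψ x := by
    intro y
    have := ha x y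
    simp only [map_mul, hx, zero_mul, Matrix.trace_zero, sub_zero, zero_smul, add_zero] at this
    rw [sub_mul, smul_mul_assoc, one_mul, ← this]; abel
  obtain ⟨y, hy⟩ := hs !![0, 1; 0, 0]
  obtain ⟨z, hz⟩ := hs !![0, 0; 1, 0]
  have hyx := h1 y
  have hzx := h1 z
  have hyzx := h1 (y * z)
  simp only [map_mul, hy, hz, Matrix.trace_fin_two] at hyx hzx hyzx
  simp at hyx hzx hyzx
  have h2 : (ψ y * ψ z - ψ z * ψ y) * ψ x = 0 := by
    have e1 : ψ x * (ψ y * ψ z) = ψ y * ψ z * ψ x := by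
      rw [← mul_assoc, hyx, neg_mul, mul_assoc, hzx, mul_neg, neg_neg, mul_assoc]
    have hyz := ha y z
    simp only [map_mul, hy, hz, Matrix.trace_fin_two] at hyz
    simp at hyz
    have e3 : ψ x * (ψ y * ψ z) = ψ z * ψ y * ψ x := by
      rw [hyzx, ← hyz]; congr 1; abel
    rw [sub_mul, ← e1, ← e3, sub_self]
  have h3 := hq (y * z - z * y)
  simp only [map_mul, map_sub, hy, hz, Matrix.trace_fin_two, Matrix.det_fin_two] at h3
  simp at h3
  have : (ψ y * ψ z - ψ z * ψ y) * (ψ y * ψ z - ψ z * ψ y) = 1 := by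
    rw [← sub_eq_zero, sub_eq_add_neg]; exact h3
  rw [← one_mul (ψ x), ← this, mul_assoc, h2, mul_zero]

theorem ha_of {A G S : Type*} [CommRing A] [Group G] [Ring S] [Algebra A S]
    (φ : MonoidAlgebra A G →ₐ[A] Matrix (Fin 2) (Fin 2) A) (ψ : MonoidAlgebra A G →ₐ[A] S)
    (hc : ∀ g : G, ψ (.of A G g) * ψ (.of A G g) - (φ (.of A G g)).trace • ψ (.of A G g)
       + (φ (.of A G g)).det • (1 : S) = 0) (x y : MonoidAlgebra A G) :
    ψ (x * y) + ψ (y * x) = (φ y).trace • ψ x + (φ x).trace • ψ y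
      + ((φ (x * y)).trace - (φ x).trace * (φ y).trace) • (1 : S) := by
  have hs : ∀ g : G, (φ (.of A G g)).trace • (1 : S) - ψ (.of A G g) =
      (φ (.of A G g)).det • ψ (.of A G g⁻¹) := by
    intro g
    have h1 : ψ (.of A G g) * ψ (.of A G g⁻¹) = 1 := by
      rw [← map_mul, ← map_mul, mul_inv_cancel, map_one, map_one]
    have := congrArg (· * ψ (.of A G g⁻¹)) (hc g)
    simp only [add_mul, sub_mul, mul_assoc, h1, smul_mul_assoc, one_mul, mul_one, zero_mul] at this
    rw [← sub_eq_zero, ← neg_eq_zero, ← this]; abel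
  induction x using MonoidAlgebra.induction_on with
  | of g =>
    induction y using MonoidAlgebra.induction_on with
    | of h =>
      have h3 := hs (g * h)
      rw [mul_inv_rev, map_mul, map_mul, Matrix.det_mul, map_mul, map_mul, map_mul,
        mul_comm (Matrix.det _), ← smul_mul_smul_comm,
        ← hs, ← hs] at h3
      simp only [sub_mul, mul_sub, smul_mul_assoc, mul_smul_comm, one_mul, mul_one, smul_sub] at h3
      rw [← map_mul, ← map_mul] at h3
      simp only [sub_smul, mul_smul, map_mul] at h3 ⊢
      rw [sub_eq_iff_eq_add] at h3
      rw [h3]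
      abel
    | add y z hy hz =>
      simp only [mul_add, add_mul, map_add, Matrix.trace_add] at *
      rw [add_add_add_comm, hy, hz]
      module
    | smul a y hy =>
      simp only [mul_smul_comm, smul_mul_assoc, map_smul, Matrix.trace_smul, ← smul_add, hy]
      simp only [smul_eq_mul]
      module
  | add x z hy hz =>
    simp only [mul_add, add_mul, map_add, Matrix.trace_add] at *
    rw [add_add_add_comm, hy, hz]
    module
  | smul a x hy =>
    simp only [mul_smul_comm, smul_mul_assoc, map_smul, Matrix.trace_smul, ← smul_add, hy]
    simp only [smul_eq_mul]
    module

theorem hq_of {A G S : Type*} [CommRing A] [Group G] [Ring S] [Algebra A S]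
    (φ : MonoidAlgebra A G →ₐ[A] Matrix (Fin 2) (Fin 2) A) (ψ : MonoidAlgebra A G →ₐ[A] S)
    (hc : ∀ g : G, ψ (.of A G g) * ψ (.of A G g) - (φ (.of A G g)).trace • ψ (.of A G g)
       + (φ (.of A G g)).det • (1 : S) = 0) (x : MonoidAlgebra A G) :
    ψ x * ψ x - (φ x).trace • ψ x + (φ x).det • (1 : S) = 0 := by
  induction x using MonoidAlgebra.induction_on with
  | of g => exact hc g
  | add x y hx hy =>
    have h := ha_of φ ψ hc x y
    have hd : (φ x + φ y).det = (φ x).det + (φ y).det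
        - ((φ (x * y)).trace - (φ x).trace * (φ y).trace) := by
      rw [map_mul]
      simp only [Matrix.det_fin_two, Matrix.trace_fin_two, Matrix.mul_apply, Fin.sum_univ_two,
        Matrix.add_apply]
      ring
    rw [map_add, map_add, hd, Matrix.trace_add]
    simp only [map_mul ψ] at h
    rw [sub_smul ((φ x).det + (φ y).det), ← sub_eq_iff_eq_add'.mpr h]
    simp only [mul_add, add_mul, add_smul, smul_add]
    rw [← add_zero (0 : S)]
    nth_rewrite 1 [← hx]
    rw [← hy]
    abel
  | smul a x hx =>
    rw [map_smul, map_smul, Matrix.trace_smul, Matrix.det_smul]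
    have := congrArg (a^2 • ·) hx
    simp only [smul_zero] at this
    rw [← this]
    simp only [smul_mul_smul_comm, smul_eq_mul, Fintype.card_fin]
    module

theorem burnside_span {K M G : Type*} [Field K] [IsAlgClosed K] [AddCommGroup M] [Module K M]
    [FiniteDimensional K M] [Nontrivial M] [Group G] (τ : Representation K G M)
    (h : ∀ W : Submodule K M, (∀ g, ∀ x ∈ W, τ g x ∈ W) → W = ⊥ ∨ W = ⊤) :
    Submodule.span K (Set.range τ) = ⊤ := by
  let S : Subalgebra K (Module.End K M) := Algebra.adjoin K (Set.range τ)
  have hS : ∀ g, τ g ∈ S := fun g => Algebra.subset_adjoin ⟨g, rfl⟩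
  have : IsSimpleModule S M := by
    rw [isSimpleModule_iff]
    refine { eq_bot_or_eq_top := fun W => ?_ }
    rcases h (W.restrictScalars K) (fun g x hx => W.smul_mem (⟨τ g, hS g⟩ : S) hx) with h | h
    · left; simpa using h
    · right; simpa using h
  have hb := IsSimpleModule.algebraMap_end_bijective_of_isAlgClosed (A := S) (V := M) K
  have hadj : Subalgebra.toSubmodule S = Submodule.span K (Set.range τ) := by
    have e : Set.range τ = ((MonoidHom.mrange τ : Submonoid _) : Set (Module.End K M)) := rfl
    rw [Algebra.adjoin_eq_span, e, Submonoid.closure_eq]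
  rw [← hadj, eq_top_iff]
  rintro f -
  let f' : Module.End (Module.End S M) M :=
    { toFun := f
      map_add' := map_add f
      map_smul' := by
        intro c x
        obtain ⟨k, rfl⟩ := hb.2 c
        simp }
  obtain ⟨s, hs⟩ := Module.Finite.fg_top (R := K) (M := M)
  obtain ⟨r, hr⟩ := jacobson_density f' s
  have : f = r := by
    refine LinearMap.ext_on hs fun m hm => hr m hm
  rw [this]
  exact r.2

theorem span_top_gen {A M N K G ι : Type*} [CommRing A] [IsLocalRing A] [AddCommGroup M] [Module A M]
    [Field K] [Algebra A K] [AddCommGroup N] [Module K N] [Fintype ι] [DecidableEq ι]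
    (hK : ∀ a ∈ IsLocalRing.maximalIdeal A, algebraMap A K a = 0)
    (bE : Module.Basis ι A M) (bEK : Module.Basis ι K N) (f : M → N)
    (hf : ∀ m i, bEK.repr (f m) i = algebraMap A K (bE.repr m i)) (v : G → M)
    (hτ : Submodule.span K (Set.range fun g => f (v g)) = ⊤) :
    Submodule.span A (Set.range v) = ⊤ := by
  obtain ⟨κ, a, ha, hsp, hli⟩ := exists_linearIndependent' K (fun g => f (v g))
  let B : Module.Basis κ K N := Module.Basis.mk hli (by rw [hsp, hτ])
  let e := B.indexEquiv bEK
  have hu : IsUnit (bEK.det (B.reindex e)) := bEK.isUnit_det (B.reindex e)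
  have hu2 : algebraMap A K (bE.det (fun i => v (a (e.symm i)))) = bEK.det (B.reindex e) := by
    rw [Module.Basis.det_apply, Module.Basis.det_apply, RingHom.map_det]
    congr 1
    ext i j
    have hB : B.reindex e j = f (v (a (e.symm j))) := by
      simp [B]
    rw [RingHom.mapMatrix_apply, Matrix.map_apply, Module.Basis.toMatrix_apply,
      Module.Basis.toMatrix_apply, hB, hf]
  have hu3 : IsUnit (bE.det (fun i => v (a (e.symm i)))) := by
    by_contra hcon
    have := hK _ hcon
    rw [hu2] at this
    exact hu.ne_zero this
  have := ((Module.Basis.is_basis_iff_det bE).mpr hu3).2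
  rw [eq_top_iff, ← this]
  apply Submodule.span_mono
  rintro _ ⟨i, rfl⟩
  exact ⟨_, rfl⟩

theorem span_top_aux {A V G : Type} [CommRing A] [IsLocalRing A] [AddCommGroup V] [Module A V]
    (b : Module.Basis (Fin 2) A V) [Group G]
    (ρ : Representation A G V) (K : Type) [Field K] [Algebra A K]
    (hK : ∀ a ∈ IsLocalRing.maximalIdeal A, algebraMap A K a = 0)
    (hτ : Submodule.span K (Set.range fun g => LinearMap.baseChange K (ρ g)) = ⊤) :
    Submodule.span A (Set.range ρ) = ⊤ := by
  let bK := Algebra.TensorProduct.basis K b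
  refine span_top_gen hK ((Matrix.stdBasis A (Fin 2) (Fin 2)).map (LinearMap.toMatrix b b).symm)
    ((Matrix.stdBasis K (Fin 2) (Fin 2)).map (LinearMap.toMatrix bK bK).symm)
    (fun f => LinearMap.baseChange K f) ?_ ρ hτ
  intro m i
  have h1 := congrFun (congrFun (LinearMap.toMatrix_baseChange K m b b) i.1) i.2
  exact h1

theorem span_top_A {A V G : Type} [CommRing A] [IsLocalRing A] [AddCommGroup V] [Module A V]
    [Module.Free A V] [Module.Finite A V] (b : Module.Basis (Fin 2) A V) [Group G]
    (ρ : Representation A G V)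
    (hirr : ∀ (K : Type) [Field K] [Algebra A K],
      (∀ a ∈ IsLocalRing.maximalIdeal A, algebraMap A K a = 0) →
      ∀ W : Submodule K (K ⊗[A] V),
        (∀ (g : G), ∀ x ∈ W, LinearMap.baseChange K (ρ g) x ∈ W) → W = ⊥ ∨ W = ⊤) :
    Submodule.span A (Set.range ρ) = ⊤ := by
  let K := AlgebraicClosure (IsLocalRing.ResidueField A)
  have hK : ∀ a ∈ IsLocalRing.maximalIdeal A, algebraMap A K a = 0 := by
    intro a ha
    rw [IsScalarTower.algebraMap_apply A (IsLocalRing.ResidueField A) K]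
    rw [IsLocalRing.ResidueField.algebraMap_eq, (IsLocalRing.residue_eq_zero_iff a).mpr ha, map_zero]
  let bK := Algebra.TensorProduct.basis K b
  have : FiniteDimensional K (K ⊗[A] V) := inferInstance
  have : Nontrivial (K ⊗[A] V) := ⟨bK 0, bK 1, fun h => by simpa using bK.injective h⟩
  let τ : Representation K G (K ⊗[A] V) :=
    { toFun := fun g => LinearMap.baseChange K (ρ g)
      map_one' := by rw [map_one]; exact LinearMap.baseChange_id
      map_mul' := fun g h => by rw [map_mul]; exact LinearMap.baseChange_comp _ _ }
  have hτ := burnside_span τ (hirr K hK)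
  exact span_top_aux b ρ K hK hτ

universe u

theorem morita {A V W : Type} [CommRing A] [AddCommGroup V] [Module A V] [AddCommGroup W] [Module A W]
    (b : Module.Basis (Fin 2) A V) (ψ : Module.End A V →ₐ[A] Module.End A W) :
    ∃ (U₀ : ModuleCat.{u} A) (e : W ≃ₗ[A] V ⊗[A] U₀),
      ∀ (f : Module.End A V) (x : W), e (ψ f x) = LinearMap.rTensor U₀ f (e x) := by
  let E : V →ₗ[A] (Fin 2) → Module.End A V := LinearMap.pi fun i => 
     (LinearMap.smulRightₗ (b.coord i))
  have hE : ∀ v i x, E v i x = b.coord i x • v := fun v i x => by simp [E]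
  have hmul : ∀ (f : Module.End A V) v i, f * E v i = E (f v) i := by
    intro f v i; ext x; simp [hE]
  have hmul2 : ∀ v i w j, E v i * E w j = b.coord i w • E v j := by
    intro v i w j; ext x; rw [Module.End.mul_apply, LinearMap.smul_apply, hE, hE, hE, map_smul, smul_eq_mul, mul_comm, mul_smul]
  have hsum : ∑ i, E (b i) i = 1 := by
    ext x; rw [LinearMap.sum_apply]; simp only [hE]; exact b.sum_repr x
  let U : Submodule A W := LinearMap.range (ψ (E (b 0) 0))
  have hU : ∀ u ∈ U, ψ (E (b 0) 0) u = u := by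
    rintro _ ⟨w, rfl⟩
    rw [← Module.End.mul_apply, ← map_mul, hmul2]; simp
  have hm : ∀ i w, ψ (E (b 0) i) w ∈ U := fun i w =>
    ⟨ψ (E (b 0) i) w, by rw [← Module.End.mul_apply, ← map_mul, hmul2]; simp⟩
  let p : Fin 2 → W →ₗ[A] U := fun i => (ψ (E (b 0) i)).codRestrict U (hm i)
  let F : W →ₗ[A] V ⊗[A] U := ∑ i, (TensorProduct.mk A V U (b i)) ∘ₗ p i
  let H : V ⊗[A] U →ₗ[A] W := TensorProduct.lift
    { toFun := fun v => (ψ (E v 0)) ∘ₗ U.subtype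
      map_add' := fun v w => by ext; simp
      map_smul' := fun c w => by ext; simp }
  have hH : ∀ v (u : U), H (v ⊗ₜ u) = ψ (E v 0) u := fun v u => rfl
  have hHF : ∀ w, H (F w) = w := by
    intro w
    simp only [F, LinearMap.sum_apply, map_sum, LinearMap.comp_apply, TensorProduct.mk_apply, hH]
    have : ∀ i, ψ (E (b i) 0) (p i w) = ψ (E (b i) i) w := by
      intro i
      change ψ (E (b i) 0) (ψ (E (b 0) i) w) = _
      rw [← Module.End.mul_apply, ← map_mul, hmul2]; simp
    simp only [this]
    rw [← LinearMap.sum_apply, ← map_sum, hsum, map_one, Module.End.one_apply]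
  have hpE : ∀ i v (u : U), p i (ψ (E v 0) u) = b.coord i v • u := by
    intro i v u
    ext
    change ψ (E (b 0) i) (ψ (E v 0) u) = _
    rw [← Module.End.mul_apply, ← map_mul, hmul2, map_smul, LinearMap.smul_apply, hU _ u.2]
    rfl
  have hFH : F ∘ₗ H = LinearMap.id := by
    ext v u
    change F (H (v ⊗ₜ u)) = v ⊗ₜ u
    simp only [F, hH, LinearMap.sum_apply, LinearMap.comp_apply, TensorProduct.mk_apply, hpE,
      TensorProduct.tmul_smul, TensorProduct.smul_tmul', ← TensorProduct.sum_tmul]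
    congr 1
    exact b.sum_repr v
  have hHf : ∀ f, H ∘ₗ LinearMap.rTensor U f = ψ f ∘ₗ H := by
    intro f
    ext v u
    change H (f v ⊗ₜ u) = ψ f (H (v ⊗ₜ u))
    rw [hH, hH, ← Module.End.mul_apply, ← map_mul, hmul]
  let q : V ⊗[A] U ≃ₗ[A] V ⊗[A] (ULift.{u} U) :=
    TensorProduct.congr (LinearEquiv.refl A V) ULift.moduleEquiv.symm
  have hq : ∀ f, q.toLinearMap ∘ₗ LinearMap.rTensor U f = LinearMap.rTensor (ULift.{u} U) f ∘ₗ q.toLinearMap := by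
    intro f
    ext v u
    simp [q]
  let e0 : W ≃ₗ[A] V ⊗[A] U := LinearEquiv.ofLinearMap F H hFH (LinearMap.ext hHF)
  refine ⟨ModuleCat.of A (ULift.{u} U), e0.trans q, fun f x => ?_⟩
  change q (F (ψ f x)) = LinearMap.rTensor (ULift.{u} U) f (q (F x))
  have h2 : F (ψ f x) = LinearMap.rTensor U f (F x) := by
    conv_lhs => rw [← hHF x]
    have := LinearMap.congr_fun (hHf f) (F x)
    simp only [LinearMap.comp_apply] at this
    rw [← this]
    exact LinearMap.congr_fun hFH _
  rw [h2]
  exact LinearMap.congr_fun (hq f) (F x)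

/-- Theorem of Boston–Lenstra–Ribet type, ring coefficients:
let `A` be a complete Noetherian local commutative ring, `G` a group, `V` a free
`A`-module of rank 2 and `ρ : G → Aut_A(V)` a representation whose reduction modulo the
maximal ideal is absolutely irreducible (for every field extension `K` of the residue
field `k = A/m_A`, the base change of `ρ̄` to `K` has no nontrivial invariant subspaces).
If `W` is a finitely generated `A`-module and `σ : G → Aut_A(W)` is a representation such
that `σ(g)² - (tr ρ(g))·σ(g) + (det ρ(g))·id = 0` for all `g ∈ G`, then there is an
`A`-module `U₀` and an isomorphism of `A[G]`-modules `σ ≅ ρ ⊗_A U₀`. -/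
theorem blr_tensor_decomposition
    {A : Type} [CommRing A] [IsLocalRing A] [IsNoetherianRing A]
    [IsAdicComplete (IsLocalRing.maximalIdeal A) A]
    {V : Type} [AddCommGroup V] [Module A V] [Module.Free A V] [Module.Finite A V]
    (hrank : Module.finrank A V = 2)
    {G : Type} [Group G] (ρ : Representation A G V)
    (hirr : ∀ (K : Type) [Field K] [Algebra A K],
      (∀ a ∈ IsLocalRing.maximalIdeal A, algebraMap A K a = 0) →
      ∀ W : Submodule K (K ⊗[A] V),
        (∀ (g : G), ∀ x ∈ W, LinearMap.baseChange K (ρ g) x ∈ W) → W = ⊥ ∨ W = ⊤)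
    {W : Type} [AddCommGroup W] [Module A W] [Module.Finite A W]
    (σ : Representation A G W)
    (hchar : ∀ g : G, (σ g).comp (σ g)
        - LinearMap.trace A V (ρ g) • σ g
        + LinearMap.det (ρ g) • (LinearMap.id : W →ₗ[A] W) = 0) :
    ∃ (U₀ : ModuleCat A) (e : W ≃ₗ[A] V ⊗[A] U₀),
      ∀ (g : G) (x : W), e (σ g x) = LinearMap.rTensor U₀ (ρ g) (e x) := by
  classical
  have b : Module.Basis (Fin 2) A V := Module.finBasisOfFinrankEq A V hrank
  let T := LinearMap.toMatrixAlgEquiv b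
  let φ : MonoidAlgebra A G →ₐ[A] Matrix (Fin 2) (Fin 2) A := T.toAlgHom.comp ρ.asAlgebraHom
  let ψ : MonoidAlgebra A G →ₐ[A] Module.End A W := σ.asAlgebraHom
  have hφ : ∀ g, φ (.of A G g) = LinearMap.toMatrix b b (ρ g) := fun g => by
    change T (ρ.asAlgebraHom _) = _
    rw [Representation.asAlgebraHom_of]; rfl
  have hc : ∀ g : G, ψ (.of A G g) * ψ (.of A G g) - (φ (.of A G g)).trace • ψ (.of A G g)
       + (φ (.of A G g)).det • (1 : Module.End A W) = 0 := by
    intro g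
    have := hchar g
    rw [LinearMap.trace_eq_matrix_trace A b, ← LinearMap.det_toMatrix b, ← hφ] at this
    simp only [ψ, Representation.asAlgebraHom_of]
    exact this
  have hsρ : Function.Surjective ρ.asAlgebraHom := by
    rw [← AlgHom.coe_toLinearMap, ← LinearMap.range_eq_top, eq_top_iff, ← span_top_A b ρ hirr,
      Submodule.span_le]
    rintro _ ⟨g, rfl⟩
    exact ⟨.of A G g, Representation.asAlgebraHom_of ρ g⟩
  have hs : Function.Surjective φ := T.surjective.comp hsρ
  have hker : ∀ x, ρ.asAlgebraHom x = 0 → ψ x = 0 := fun x hx =>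
    core_ker φ ψ (ha_of φ ψ hc) (hq_of φ ψ hc) hs x (by
      change T (ρ.asAlgebraHom x) = 0
      rw [hx, map_zero])
  obtain ⟨r, hr⟩ := hsρ.hasRightInverse
  have key : ∀ x y, ρ.asAlgebraHom x = ρ.asAlgebraHom y → ψ x = ψ y := fun x y h => by
    rw [← sub_eq_zero, ← map_sub]
    exact hker _ (by rw [map_sub, h, sub_self])
  let ψ' : Module.End A V →ₐ[A] Module.End A W :=
    { toFun := fun f => ψ (r f)
      map_one' := by rw [← map_one ψ]; exact key _ _ (by rw [hr, map_one])
      map_mul' := fun f g => by rw [← map_mul ψ]; exact key _ _ (by rw [map_mul, hr, hr, hr])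
      map_zero' := by rw [← map_zero ψ]; exact key _ _ (by rw [hr, map_zero])
      map_add' := fun f g => by rw [← map_add ψ]; exact key _ _ (by rw [map_add, hr, hr, hr])
      commutes' := fun c => by
        rw [← AlgHom.commutes ψ]; exact key _ _ (by rw [hr, AlgHom.commutes]) }
  obtain ⟨U₀, e, he⟩ := morita b ψ'
  refine ⟨U₀, e, fun g x => ?_⟩
  rw [← he]
  congr 1
  have : ψ' (ρ g) = σ g := by
    change ψ (r (ρ g)) = _
    rw [← Representation.asAlgebraHom_of σ]
    exact key _ _ (by rw [hr, Representation.asAlgebraHom_of])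
  rw [this]
end

section
/- The A-algebra homomorphism ρ : A[G] → End_A(V) is surjective and its kernel equals J; in other words, it induces an isomorphism of A-algebras A[G]/J ≅ End_A(V). -/
open TensorProduct

/-- The two-sided ideal `J ⊆ A[G]` generated by the elements
`g² − (tr ρ(g))·g + (det ρ(g))·1`, for `g ∈ G`. -/
noncomputable def blrIdeal {A : Type} [CommRing A]
    {V : Type} [AddCommGroup V] [Module A V] [Module.Free A V] [Module.Finite A V]
    {G : Type} [Group G] (ρ : Representation A G V) :
    TwoSidedIdeal (MonoidAlgebra A G) :=
  TwoSidedIdeal.span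
    {x : MonoidAlgebra A G | ∃ g : G,
      x = MonoidAlgebra.of A G g * MonoidAlgebra.of A G g
        - LinearMap.trace A V (ρ g) • MonoidAlgebra.of A G g
        + LinearMap.det (ρ g) • (1 : MonoidAlgebra A G)}

lemma burnside_aux {K W : Type} [Field K] [IsAlgClosed K] [AddCommGroup W] [Module K W]
    [FiniteDimensional K W] [Nontrivial W] (S : Subalgebra K (Module.End K W))
    (h : ∀ p : Submodule K W, (∀ f ∈ S, ∀ x ∈ p, f x ∈ p) → p = ⊥ ∨ p = ⊤) : S = ⊤ := by
  haveI : IsSimpleModule S W :=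
    { exists_pair_ne := ⟨⊥, ⊤, bot_ne_top⟩
      eq_bot_or_eq_top := fun p => by
        rcases h (p.restrictScalars K) (fun f hf x hx => p.smul_mem (⟨f, hf⟩ : S) hx) with h | h
        · left; exact (Submodule.restrictScalars_eq_bot_iff _ _ _).1 h
        · right; exact (Submodule.restrictScalars_eq_top_iff _ _ _).1 h }
  rw [eq_top_iff]
  intro f _
  have hs := (IsSimpleModule.algebraMap_end_bijective_of_isAlgClosed (A := S) (V := W) K).2
  let F : Module.End (Module.End S W) W :=
    { toFun := f
      map_add' := f.map_add
      map_smul' := fun c x => by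
        obtain ⟨a, rfl⟩ := hs c
        simp [Module.End.smul_def, Module.algebraMap_end_apply] }
  obtain ⟨s, hsp⟩ := (Module.Finite.fg_top (R := K) (M := W))
  obtain ⟨r, hr⟩ := jacobson_density (R := S) F s
  have : f = r.1 := by
    refine LinearMap.ext_on hsp (fun x hx => hr x hx)
  rw [this]; exact r.2

lemma surj_aux {A : Type} [CommRing A] [IsLocalRing A]
    {E : Type} [AddCommGroup E] [Module A E] [Module.Finite A E] (S : Submodule A E)
    (K : Type) [Field K] [Algebra A K] [Algebra (IsLocalRing.ResidueField A) K]
    [IsScalarTower A (IsLocalRing.ResidueField A) K]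
    (h : Submodule.span K ((fun f : E => (1 : K) ⊗ₜ[A] f) '' S) = ⊤) : S = ⊤ := by
  have hQ : Subsingleton (K ⊗[A] (E ⧸ S)) := by
    have hz : (S.mkQ.baseChange K) = 0 := by
      refine LinearMap.ext_on h ?_
      rintro _ ⟨f, hf, rfl⟩
      simp only [LinearMap.baseChange_tmul, LinearMap.zero_apply]
      rw [Submodule.mkQ_apply, (Submodule.Quotient.mk_eq_zero S).2 hf, tmul_zero]
    have hsj : Function.Surjective (S.mkQ.baseChange K) :=
      LinearMap.lTensor_surjective K S.mkQ_surjective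
    rw [subsingleton_iff_forall_eq 0]
    intro y
    obtain ⟨x, rfl⟩ := hsj y
    rw [hz]; rfl
  have e := TensorProduct.AlgebraTensorModule.cancelBaseChange A (IsLocalRing.ResidueField A) K K (E ⧸ S)
  have h2 : Subsingleton (K ⊗[IsLocalRing.ResidueField A] ((IsLocalRing.ResidueField A) ⊗[A] (E ⧸ S))) :=
    e.toEquiv.subsingleton
  rw [Module.FaithfullyFlat.subsingleton_tensorProduct_iff_right,
    IsLocalRing.subsingleton_tensorProduct] at h2
  exact Submodule.Quotient.subsingleton_iff.1 h2

lemma ch_aux {A V : Type} [CommRing A] [Nontrivial A] [AddCommGroup V] [Module A V] [Module.Free A V]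
    [Module.Finite A V] (hrank : Module.finrank A V = 2) (f : Module.End A V) :
    f * f - LinearMap.trace A V f • f + LinearMap.det f • 1 = 0 := by
  let b := Module.finBasisOfFinrankEq A V hrank
  apply (LinearMap.toMatrix b b).injective
  have h1 : LinearMap.toMatrix b b (1 : Module.End A V) = 1 := LinearMap.toMatrix_id b
  rw [LinearMap.trace_eq_matrix_trace A b, ← LinearMap.det_toMatrix b]
  simp only [map_add, map_sub, map_smul, map_zero, LinearMap.toMatrix_mul, h1]
  generalize LinearMap.toMatrix b b f = M
  ext i j
  fin_cases i <;> fin_cases j <;>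
    simp [Matrix.mul_apply, Fin.sum_univ_two, Matrix.trace, Matrix.det_fin_two] <;> ring

lemma surj_main
    {A : Type} [CommRing A] [IsLocalRing A]
    {V : Type} [AddCommGroup V] [Module A V] [Module.Free A V] [Module.Finite A V]
    (hrank : Module.finrank A V = 2)
    {G : Type} [Group G] (ρ : Representation A G V)
    (hirr : ∀ (K : Type) [Field K] [Algebra A K],
      (∀ a ∈ IsLocalRing.maximalIdeal A, algebraMap A K a = 0) →
      ∀ W : Submodule K (K ⊗[A] V),
        (∀ (g : G), ∀ x ∈ W, LinearMap.baseChange K (ρ g) x ∈ W) → W = ⊥ ∨ W = ⊤) :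
    Function.Surjective ρ.asAlgebraHom := by
  let k := IsLocalRing.ResidueField A
  let K := AlgebraicClosure k
  have hK := hirr K (fun a ha => by
    rw [IsScalarTower.algebraMap_apply A k K, IsLocalRing.ResidueField.algebraMap_eq,
      (IsLocalRing.residue_eq_zero_iff a).2 ha, map_zero])
  haveI : Nontrivial (K ⊗[A] V) := by
    apply Module.nontrivial_of_finrank_pos (R := K)
    rw [Module.finrank_baseChange, hrank]; norm_num
  have hbc : IsBaseChange K (LinearMap.baseChangeHom A K V V) := by
    have := IsBaseChange.end (TensorProduct.isBaseChange A V K)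
    convert this using 1
    refine LinearMap.ext fun f => ?_
    apply TensorProduct.AlgebraTensorModule.ext
    intro a v
    have h1 := IsBaseChange.endHom_comp_apply (TensorProduct.isBaseChange A V K) f v
    have h2 : a ⊗ₜ[A] v = a • (TensorProduct.mk A K V 1 v) := by simp [smul_tmul']
    rw [h2, map_smul, map_smul, h1]
    simp
  have hS : ρ.asAlgebraHom.range.toSubmodule = ⊤ := by
    apply surj_aux _ K
    have hsp : Submodule.span K (Module.End.baseChangeHom A K V '' ρ.asAlgebraHom.range) = ⊤ := by
      let M : Submonoid (Module.End K (K ⊗[A] V)) :=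
        (ρ.asAlgebraHom.range.map (Module.End.baseChangeHom A K V)).toSubmonoid
      have hB := burnside_aux (Algebra.adjoin K (M : Set (Module.End K (K ⊗[A] V)))) (fun p hp => by
        apply hK p
        intro g x hx
        refine hp _ (Algebra.subset_adjoin ?_) x hx
        exact ⟨ρ g, ⟨MonoidAlgebra.of A G g, by simp⟩, rfl⟩)
      have := Algebra.adjoin_eq_span K (M : Set (Module.End K (K ⊗[A] V)))
      rw [hB, Submonoid.closure_eq] at this
      exact this.symm
    apply (Submodule.map_injective_of_injective hbc.equiv.injective)
    rw [Submodule.map_span, ← Set.image_comp, Submodule.map_top, LinearEquiv.range, ← hsp]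
    congr 1
    apply Set.image_congr
    intro f _
    simp
    rfl
  intro f
  have : f ∈ ρ.asAlgebraHom.range.toSubmodule := hS ▸ Submodule.mem_top
  exact this

lemma core_aux {B R E A : Type} [CommRing A] [Ring B] [Ring R] [Ring E] (π : B →+* R) (φ : B →+* E)
    (c : A →+* R) (hc : ∀ a r, c a * r = r * c a) (tr : E → A) (htr : tr 0 = 0)
    (σ : B → B) (hσ : ∀ x y, σ (x * y) = σ y * σ x)
    (hT : ∀ x, π x + π (σ x) = c (tr (φ x)))
    (y z t : B) (hyz : φ ((y * z - z * y) * (y * z - z * y)) = 1) (ht : tr (φ t) = 1)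
    (x : B) (hx : φ x = 0) : π x = 0 := by
  have hI : ∀ x, φ x = 0 → π (σ x) = - π x := fun x hx => by
    have := hT x
    rw [hx, htr, map_zero] at this
    exact (neg_eq_of_add_eq_zero_right this).symm
  have h1 : ∀ x y, φ x = 0 → π y * π x = π x * π (σ y) := fun x y hx => by
    have := hI (y * x) (by simp [hx])
    rw [hσ, map_mul, map_mul, hI x hx, neg_mul, neg_inj] at this
    exact this.symm
  have h2 : ∀ x y, φ x = 0 → π x * π y = π (σ y) * π x := fun x y hx => by
    have := hI (x * y) (by simp [hx])
    rw [hσ, map_mul, map_mul, hI x hx, mul_neg, neg_inj] at this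
    exact this.symm
  have h3 : ∀ x, φ x = 0 → π x * (π y * π z - π z * π y) = 0 := fun x hx => by
    have ha : π x * (π (σ z) * π y) = π x * (π y * π (σ z)) := by
      rw [← mul_assoc, ← h1 x z hx, ← mul_assoc, ← map_mul π x y, ← h1 (x * y) z (by simp [hx]),
        map_mul, mul_assoc]
    have hz : π (σ z) = c (tr (φ z)) - π z := by rw [← hT z]; abel
    rw [hz, sub_mul, mul_sub, mul_sub, mul_sub, hc] at ha
    rw [mul_sub, sub_eq_zero]
    exact (sub_right_injective ha).symm
  set w := (y * z - z * y) * (y * z - z * y) with hw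
  have h4 : ∀ x, φ x = 0 → π x * π w = 0 := fun x hx => by
    rw [hw, map_mul, ← mul_assoc]
    simp only [map_sub, map_mul, h3 x hx, zero_mul]
  have hi : φ (w - 1) = 0 := by rw [map_sub, hyz, map_one, sub_self]
  set i := w - 1 with hidef
  have hwi : π w = 1 + π i := by rw [hidef, map_sub, map_one]; abel
  have h5 : ∀ x, φ x = 0 → π x = - (π x * π i) := fun x hx => by
    have := h4 x hx
    rw [hwi, mul_add, mul_one] at this
    exact eq_neg_of_add_eq_zero_left this
  have h6 : ∀ u, π i * π (σ u) = π i * π u := fun u => by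
    calc π i * π (σ u) = π u * π i := (h1 i u hi).symm
      _ = π u * (- (π i * π i)) := by rw [← h5 i hi]
      _ = - ((π u * π i) * π i) := by noncomm_ring
      _ = - (π i * (π (σ u) * π i)) := by rw [h1 i u hi, mul_assoc]
      _ = - ((π i * π i) * π u) := by rw [← h2 i u hi, mul_assoc]
      _ = (- (π i * π i)) * π u := by noncomm_ring
      _ = π i * π u := by rw [← h5 i hi]
  have h7 : π i + π i = 0 := by
    have := h6 i
    rw [hI i hi, mul_neg, ← h5 i hi] at this
    have h5i := h5 i hi
    rw [← this] at h5i
    nth_rewrite 1 [h5i]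
    exact neg_add_cancel _
  have h8 : π i = 0 := by
    have := hT t
    rw [ht, map_one] at this
    calc π i = π i * (π t + π (σ t)) := by rw [this, mul_one]
      _ = (π i + π i) * π t := by rw [mul_add, h6, add_mul]
      _ = 0 := by rw [h7, zero_mul]
  rw [h5 x hx, h8, mul_zero, neg_zero]

lemma ker_main {A : Type} [CommRing A] [Nontrivial A]
    {V : Type} [AddCommGroup V] [Module A V] [Module.Free A V] [Module.Finite A V]
    (hrank : Module.finrank A V = 2)
    {G : Type} [Group G] (ρ : Representation A G V)
    (hs : Function.Surjective ρ.asAlgebraHom)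
    (x : MonoidAlgebra A G) (hx : ρ.asAlgebraHom x = 0) : x ∈ blrIdeal ρ := by
  let B := MonoidAlgebra A G
  let π := (blrIdeal ρ).ringCon.mk'
  have hπ : ∀ x, π x = 0 ↔ x ∈ blrIdeal ρ := fun x => by
    rw [← TwoSidedIdeal.mem_ker, TwoSidedIdeal.ker_ringCon_mk']
  let d : G →* A := LinearMap.det.comp ρ
  let m : G →* Bᵐᵒᵖ :=
    { toFun := fun g => MulOpposite.op (MonoidAlgebra.single g⁻¹ (d g))
      map_one' := by simp; rfl
      map_mul' := fun g h => by
        rw [← MulOpposite.op_mul, MonoidAlgebra.single_mul_single, mul_inv_rev, map_mul,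
          mul_comm (d g)] }
  let σ := MonoidAlgebra.lift A Bᵐᵒᵖ G m
  let b := Module.finBasisOfFinrankEq A V hrank
  obtain ⟨y, hy⟩ := hs (Matrix.toLin b b !![0, 1; 0, 0])
  obtain ⟨z, hz⟩ := hs (Matrix.toLin b b !![0, 0; 1, 0])
  obtain ⟨t, ht⟩ := hs (Matrix.toLin b b !![1, 0; 0, 0])
  rw [← hπ]
  refine core_aux π (ρ.asAlgebraHom : B →+* Module.End A V) (π.comp (algebraMap A B)) ?_
    (LinearMap.trace A V) (map_zero _) (fun x => (σ x).unop) ?_ ?_ y z t ?_ ?_ x hx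
  · intro a r
    obtain ⟨r, rfl⟩ := RingCon.mk'_surjective _ r
    change π (algebraMap A B a) * π r = π r * π (algebraMap A B a)
    rw [← map_mul, ← map_mul, Algebra.commutes]
  · intro x y
    simp
  · intro x
    induction x using MonoidAlgebra.induction_linear with
    | zero => simp
    | add f g hf hg =>
      simp only [map_add, MulOpposite.unop_add] at hf hg ⊢
      rw [← hf, ← hg]; abel
    | single g a =>
      have hJ : MonoidAlgebra.single g⁻¹ a * (MonoidAlgebra.of A G g * MonoidAlgebra.of A G g
        - LinearMap.trace A V (ρ g) • MonoidAlgebra.of A G g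
        + LinearMap.det (ρ g) • (1 : MonoidAlgebra A G)) ∈ blrIdeal ρ :=
        TwoSidedIdeal.mul_mem_left _ _ _ (TwoSidedIdeal.subset_span ⟨g, rfl⟩)
      rw [← hπ] at hJ
      have hσ : (σ (MonoidAlgebra.single g a)).unop = MonoidAlgebra.single g⁻¹ (a * d g) := by
        change (MonoidAlgebra.lift A Bᵐᵒᵖ G m (MonoidAlgebra.single g a)).unop = _
        rw [MonoidAlgebra.lift_single, MulOpposite.unop_smul]
        change a • (MonoidAlgebra.single g⁻¹ (d g) : MonoidAlgebra A G) = _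
        rw [MonoidAlgebra.smul_single, smul_eq_mul]
      have he : MonoidAlgebra.single g⁻¹ a * (MonoidAlgebra.of A G g * MonoidAlgebra.of A G g
        - LinearMap.trace A V (ρ g) • MonoidAlgebra.of A G g
        + LinearMap.det (ρ g) • (1 : MonoidAlgebra A G)) =
          MonoidAlgebra.single g a + MonoidAlgebra.single g⁻¹ (a * d g)
            - algebraMap A B (a * LinearMap.trace A V (ρ g)) := by
        simp [mul_add, mul_sub, MonoidAlgebra.single_mul_single, MonoidAlgebra.one_def, d, B]
        abel
      rw [he, map_sub, sub_eq_zero, map_add] at hJ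
      simp only [hσ]
      rw [hJ]
      simp
  · have hyz : !![(0:A), 1; 0, 0] * !![0, 0; 1, 0] - !![0, 0; 1, 0] * !![0, 1; 0, 0]
        = !![1, 0; 0, -1] := by simp
    have h2 : !![(1:A), 0; 0, -1] * !![(1:A), 0; 0, -1] = 1 := by
      simp [Matrix.one_fin_two]
    simp only [RingHom.coe_coe, map_mul, map_sub, hy, hz]
    change (_ ∘ₗ _ - _ ∘ₗ _) ∘ₗ (_ ∘ₗ _ - _ ∘ₗ _) = _
    rw [← Matrix.toLin_mul, ← Matrix.toLin_mul, ← map_sub, hyz, ← Matrix.toLin_mul, h2,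
      Matrix.toLin_one]
    rfl
  · simp only [RingHom.coe_coe, ht]
    rw [LinearMap.trace_eq_matrix_trace A b, LinearMap.toMatrix_toLin]
    simp [Matrix.trace]

/-- with `A` a complete Noetherian local commutative ring, `V` free of rank 2
over `A`, and `ρ : G → Aut_A(V)` a representation whose residual representation is
absolutely irreducible, the `A`-algebra homomorphism `ρ : A[G] → End_A(V)` is surjective
with kernel equal to the two-sided ideal `J` generated by the elements
`g² − (tr g)·g + (det g)·1`; i.e. it induces an isomorphism `A[G]/J ≅ End_A(V)`. -/
theorem monoidAlgebra_map_to_End_surjective_with_kernel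
    {A : Type} [CommRing A] [IsLocalRing A] [IsNoetherianRing A]
    [IsAdicComplete (IsLocalRing.maximalIdeal A) A]
    {V : Type} [AddCommGroup V] [Module A V] [Module.Free A V] [Module.Finite A V]
    (hrank : Module.finrank A V = 2)
    {G : Type} [Group G] (ρ : Representation A G V)
    (hirr : ∀ (K : Type) [Field K] [Algebra A K],
      (∀ a ∈ IsLocalRing.maximalIdeal A, algebraMap A K a = 0) →
      ∀ W : Submodule K (K ⊗[A] V),
        (∀ (g : G), ∀ x ∈ W, LinearMap.baseChange K (ρ g) x ∈ W) → W = ⊥ ∨ W = ⊤) :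
    Function.Surjective ρ.asAlgebraHom ∧
      ∀ x : MonoidAlgebra A G, ρ.asAlgebraHom x = 0 ↔ x ∈ blrIdeal ρ := by
  have hs := surj_main hrank ρ hirr
  refine ⟨hs, fun x => ⟨ker_main hrank ρ hs x, fun hx => ?_⟩⟩
  have hle : blrIdeal ρ ≤ TwoSidedIdeal.ker ρ.asAlgebraHom := by
    apply TwoSidedIdeal.span_le.2
    rintro _ ⟨g, rfl⟩
    rw [SetLike.mem_coe, TwoSidedIdeal.mem_ker, map_add, map_sub, map_smul, map_smul, map_mul,
      map_one, Representation.asAlgebraHom_of]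
    exact ch_aux hrank (ρ g)
  exact (TwoSidedIdeal.mem_ker _).1 (hle hx)
end
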